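/- Suppose L is subcritical in Ω, i.e. the equation Lu = 0 has a positive classical solution on Ω but L admits no ground state in Ω. Then there exist a continuous function W > 0 on Ω and a constant λ > 0 such that the equation Lu = λWu admits a positive classical solution on Ω; in particular, the generalized principal eigenvalue λ₀(L, W, Ω) = sup{λ ∈ ℝ : Lu = λWu has a positive classical solution in Ω} is positive. -/

import Mathlib

open MeasureTheory Set Filter Topology

noncomputable section

/-- `u` is a real-valued smooth function compactly supported in `Ω`. -/
def IsSmoothCS {d : ℕ} (Ω : Set (EuclideanSpace ℝ (Fin d)))
    (u : EuclideanSpace ℝ (Fin d) → ℝ) : Prop :=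
  ContDiff ℝ (⊤ : ℕ∞) u ∧ HasCompactSupport u ∧ tsupport u ⊆ Ω

/-- The quadratic form `a[u] = ∫_Ω (A ∇u · ∇u + V u²) dx`. -/
def quadForm {d : ℕ} (Ω : Set (EuclideanSpace ℝ (Fin d)))
    (A : EuclideanSpace ℝ (Fin d) → Matrix (Fin d) (Fin d) ℝ)
    (V : EuclideanSpace ℝ (Fin d) → ℝ)
    (u : EuclideanSpace ℝ (Fin d) → ℝ) : ℝ :=
  ∫ x in Ω, ((∑ i, ∑ j, A x i j * gradient u x i * gradient u x j) + V x * (u x) ^ 2)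

/-- Convergence in `L²_loc(Ω)`. -/
def TendstoL2loc {d : ℕ} (Ω : Set (EuclideanSpace ℝ (Fin d)))
    (φk : ℕ → EuclideanSpace ℝ (Fin d) → ℝ) (φ : EuclideanSpace ℝ (Fin d) → ℝ) : Prop :=
  ∀ K : Set (EuclideanSpace ℝ (Fin d)), K ⊆ Ω → IsCompact K →
    Tendsto (fun k => ∫ x in K, (φk k x - φ x) ^ 2) atTop (nhds 0)

/-- `φ` is a null state for the form `a`: `φ ∈ L²_loc(Ω)`, `φ > 0` a.e. in `Ω`, and some
null sequence (`a[φ_k] → 0`) of test functions converges to `φ` in `L²_loc(Ω)`. -/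
def IsNullState {d : ℕ} (Ω : Set (EuclideanSpace ℝ (Fin d)))
    (A : EuclideanSpace ℝ (Fin d) → Matrix (Fin d) (Fin d) ℝ)
    (V : EuclideanSpace ℝ (Fin d) → ℝ)
    (φ : EuclideanSpace ℝ (Fin d) → ℝ) : Prop :=
  (∀ K : Set (EuclideanSpace ℝ (Fin d)), K ⊆ Ω → IsCompact K →
      IntegrableOn (fun x => (φ x) ^ 2) K) ∧
  (∀ᵐ x ∂(volume.restrict Ω), 0 < φ x) ∧
  ∃ φk : ℕ → EuclideanSpace ℝ (Fin d) → ℝ,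
    (∀ k, IsSmoothCS Ω (φk k)) ∧
    Tendsto (fun k => quadForm Ω A V (φk k)) atTop (nhds 0) ∧
    TendstoL2loc Ω φk φ

/-- The form `a` has a weighted spectral gap: a continuous `W > 0` on `Ω` with
`∫_Ω W u² ≤ a[u]` for all test functions. -/
def HasWeightedSpectralGap {d : ℕ} (Ω : Set (EuclideanSpace ℝ (Fin d)))
    (A : EuclideanSpace ℝ (Fin d) → Matrix (Fin d) (Fin d) ℝ)
    (V : EuclideanSpace ℝ (Fin d) → ℝ) : Prop :=
  ∃ W : EuclideanSpace ℝ (Fin d) → ℝ, ContinuousOn W Ω ∧ (∀ x ∈ Ω, 0 < W x) ∧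
    ∀ u, IsSmoothCS Ω u → ∫ x in Ω, W x * (u x) ^ 2 ≤ quadForm Ω A V u

/-- The Schrödinger operator `L u = -div(A ∇u) + V u`, evaluated pointwise. -/
def Lop {d : ℕ} (A : EuclideanSpace ℝ (Fin d) → Matrix (Fin d) (Fin d) ℝ)
    (V : EuclideanSpace ℝ (Fin d) → ℝ) (u : EuclideanSpace ℝ (Fin d) → ℝ)
    (x : EuclideanSpace ℝ (Fin d)) : ℝ :=
  -(∑ i, fderiv ℝ (fun y => ∑ j, A y i j * gradient u y j) x (EuclideanSpace.single i 1)) +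
    V x * u x

/-- `u` is a positive classical solution of `Lu = 0` on the open set `U`. -/
def IsPosSolutionOn {d : ℕ} (A : EuclideanSpace ℝ (Fin d) → Matrix (Fin d) (Fin d) ℝ)
    (V : EuclideanSpace ℝ (Fin d) → ℝ) (u : EuclideanSpace ℝ (Fin d) → ℝ)
    (U : Set (EuclideanSpace ℝ (Fin d))) : Prop :=
  ContDiffOn ℝ 2 u U ∧ (∀ x ∈ U, 0 < u x) ∧ ∀ x ∈ U, Lop A V u x = 0

/-- `u` has minimal growth in a neighborhood of infinity in `Ω`: for every nonempty open
`K₁` with compact closure contained in `Ω` and every positive supersolution-comparison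
function `v` (continuous on `cl(Ω ∖ K₁)` and a positive classical solution on
`Ω ∖ cl K₁`), `u ≤ v` on `∂K₁` implies `u ≤ v` on `Ω ∖ K₁`. -/
def HasMinimalGrowthAtInfinity {d : ℕ} (Ω : Set (EuclideanSpace ℝ (Fin d)))
    (A : EuclideanSpace ℝ (Fin d) → Matrix (Fin d) (Fin d) ℝ)
    (V : EuclideanSpace ℝ (Fin d) → ℝ) (u : EuclideanSpace ℝ (Fin d) → ℝ) : Prop :=
  ∀ K₁ : Set (EuclideanSpace ℝ (Fin d)), IsOpen K₁ → K₁.Nonempty →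
    IsCompact (closure K₁) → closure K₁ ⊆ Ω →
    ∀ v : EuclideanSpace ℝ (Fin d) → ℝ, ContinuousOn v (closure (Ω \ K₁)) →
      IsPosSolutionOn A V v (Ω \ closure K₁) →
      (∀ x ∈ frontier K₁, u x ≤ v x) → ∀ x ∈ Ω \ K₁, u x ≤ v x

/-- `φ` is a ground state of `L` in `Ω`: a positive classical solution of `Lφ = 0` in `Ω`
of minimal growth in a neighborhood of infinity in `Ω`. -/
def IsGroundState {d : ℕ} (Ω : Set (EuclideanSpace ℝ (Fin d)))
    (A : EuclideanSpace ℝ (Fin d) → Matrix (Fin d) (Fin d) ℝ)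
    (V : EuclideanSpace ℝ (Fin d) → ℝ) (φ : EuclideanSpace ℝ (Fin d) → ℝ) : Prop :=
  IsPosSolutionOn A V φ Ω ∧ HasMinimalGrowthAtInfinity Ω A V φ

section NondivergenceForm

variable {d : ℕ} {A : EuclideanSpace ℝ (Fin d) → Matrix (Fin d) (Fin d) ℝ}
  {V : EuclideanSpace ℝ (Fin d) → ℝ} {Ω : Set (EuclideanSpace ℝ (Fin d))}
  {x : EuclideanSpace ℝ (Fin d)}

/-- The `j`-th standard basis vector. -/
abbrev stdVec {d : ℕ} (j : Fin d) : EuclideanSpace ℝ (Fin d) := EuclideanSpace.single j 1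

/-- The bilinear form `A p · q` on covectors. -/
def coForm {d : ℕ} (A : EuclideanSpace ℝ (Fin d) → Matrix (Fin d) (Fin d) ℝ)
    (x : EuclideanSpace ℝ (Fin d)) (p q : EuclideanSpace ℝ (Fin d) →L[ℝ] ℝ) : ℝ :=
  ∑ i, ∑ j, A x i j * p (stdVec i) * q (stdVec j)

/-- The operator `div(A ∇u)` in nondivergence form. -/
def ndiv {d : ℕ} (A : EuclideanSpace ℝ (Fin d) → Matrix (Fin d) (Fin d) ℝ)
    (u : EuclideanSpace ℝ (Fin d) → ℝ) (x : EuclideanSpace ℝ (Fin d)) : ℝ :=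
  ∑ i, ∑ j, (fderiv ℝ (fun y => A y i j) x (stdVec i) * fderiv ℝ u x (stdVec j) +
    A x i j * fderiv ℝ (fderiv ℝ u) x (stdVec i) (stdVec j))

theorem gradient_apply_eq_fderiv (u : EuclideanSpace ℝ (Fin d) → ℝ) (j : Fin d) :
    gradient u x j = fderiv ℝ u x (stdVec j) := by
  rw [← toDual_gradient, InnerProductSpace.toDual_apply_apply, stdVec,
    EuclideanSpace.inner_single_right]
  simp

theorem ContDiffAt.hasFDerivAt_fderiv {E F : Type*} [NormedAddCommGroup E] [NormedSpace ℝ E]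
    [NormedAddCommGroup F] [NormedSpace ℝ F] {u : E → F} {x : E} (hu : ContDiffAt ℝ 2 u x) :
    HasFDerivAt (fderiv ℝ u) (fderiv ℝ (fderiv ℝ u) x) x :=
  ((hu.fderiv_right (m := 1) (by norm_num)).differentiableAt (by norm_num)).hasFDerivAt

theorem ContDiffAt.eventually_differentiableAt {E F : Type*} [NormedAddCommGroup E]
    [NormedSpace ℝ E] [NormedAddCommGroup F] [NormedSpace ℝ F] {u : E → F} {x : E}
    (hu : ContDiffAt ℝ 2 u x) : ∀ᶠ y in 𝓝 x, DifferentiableAt ℝ u y :=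
  (hu.eventually (by simp)).mono fun _ h => h.differentiableAt (by norm_num)

theorem Lop_eq_ndiv {u : EuclideanSpace ℝ (Fin d) → ℝ}
    (hA : ∀ i j, DifferentiableAt ℝ (fun y => A y i j) x) (hu : ContDiffAt ℝ 2 u x) :
    Lop A V u x = -ndiv A u x + V x * u x := by
  simp only [Lop, ndiv, gradient_apply_eq_fderiv]
  congr 2
  refine Finset.sum_congr rfl fun i _ => ?_
  have h : ∀ j ∈ Finset.univ, HasFDerivAt (fun y => A y i j * fderiv ℝ u y (stdVec j)) _ x :=
    fun j _ => (hA i j).hasFDerivAt.mul (hu.hasFDerivAt_fderiv.clm_apply (hasFDerivAt_const _ x))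
  rw [(HasFDerivAt.fun_sum h).fderiv]
  simp only [sum_apply]
  refine Finset.sum_congr rfl fun j _ => ?_
  simp
  ring

theorem fderiv_fderiv_comp {q : EuclideanSpace ℝ (Fin d) → ℝ} {f f' : ℝ → ℝ} {f'' : ℝ}
    (hf : ∀ t, HasDerivAt f (f' t) t) (hf' : HasDerivAt f' f'' (q x)) (hq : ContDiffAt ℝ 2 q x)
    (v w : EuclideanSpace ℝ (Fin d)) :
    fderiv ℝ (fderiv ℝ (fun y => f (q y))) x v w =
      f' (q x) * fderiv ℝ (fderiv ℝ q) x v w + f'' * fderiv ℝ q x v * fderiv ℝ q x w := by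
  have h : fderiv ℝ (fun y => f (q y)) =ᶠ[𝓝 x] fun y => f' (q y) • fderiv ℝ q y :=
    hq.eventually_differentiableAt.mono fun y hy =>
      ((hf (q y)).comp_hasFDerivAt y hy.hasFDerivAt).fderiv
  have h1 := hf'.comp_hasFDerivAt x (hq.differentiableAt (by norm_num)).hasFDerivAt
  have h2 : HasFDerivAt (fun y => f' (q y) • fderiv ℝ q y) _ x := h1.smul hq.hasFDerivAt_fderiv
  rw [h.fderiv_eq, h2.fderiv]
  simp

theorem fderiv_fderiv_mul {u g : EuclideanSpace ℝ (Fin d) → ℝ}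
    (hu : ContDiffAt ℝ 2 u x) (hg : ContDiffAt ℝ 2 g x) (v w : EuclideanSpace ℝ (Fin d)) :
    fderiv ℝ (fderiv ℝ (fun y => u y * g y)) x v w =
      u x * fderiv ℝ (fderiv ℝ g) x v w + fderiv ℝ u x v * fderiv ℝ g x w +
        (g x * fderiv ℝ (fderiv ℝ u) x v w + fderiv ℝ g x v * fderiv ℝ u x w) := by
  have h : fderiv ℝ (fun y => u y * g y) =ᶠ[𝓝 x]
      fun y => u y • fderiv ℝ g y + g y • fderiv ℝ u y := by
    filter_upwards [hu.eventually_differentiableAt, hg.eventually_differentiableAt] with y h1 h2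
    exact (h1.hasFDerivAt.mul h2.hasFDerivAt).fderiv
  have h1 := (hu.differentiableAt (by norm_num)).hasFDerivAt
  have h2 := (hg.differentiableAt (by norm_num)).hasFDerivAt
  have h3 : HasFDerivAt (fun y => u y • fderiv ℝ g y + g y • fderiv ℝ u y) _ x :=
    (h1.smul hg.hasFDerivAt_fderiv).add (h2.smul hu.hasFDerivAt_fderiv)
  rw [h.fderiv_eq, h3.fderiv]
  simp

theorem fderiv_fderiv_sub_const_mul {u h : EuclideanSpace ℝ (Fin d) → ℝ} (c : ℝ)
    (hu : ContDiffAt ℝ 2 u x) (hh : ContDiffAt ℝ 2 h x) :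
    fderiv ℝ (fderiv ℝ (fun y => u y - c * h y)) x =
      fderiv ℝ (fderiv ℝ u) x - c • fderiv ℝ (fderiv ℝ h) x := by
  have h' : fderiv ℝ (fun y => u y - c * h y) =ᶠ[𝓝 x]
      fun y => fderiv ℝ u y - c • fderiv ℝ h y := by
    filter_upwards [hu.eventually_differentiableAt, hh.eventually_differentiableAt] with y h1 h2
    exact (h1.hasFDerivAt.sub (h2.hasFDerivAt.const_mul c)).fderiv
  rw [h'.fderiv_eq]
  exact (hu.hasFDerivAt_fderiv.sub (hh.hasFDerivAt_fderiv.const_smul c)).fderiv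

theorem ndiv_comp {q : EuclideanSpace ℝ (Fin d) → ℝ} {f f' : ℝ → ℝ} {f'' : ℝ}
    (hf : ∀ t, HasDerivAt f (f' t) t) (hf' : HasDerivAt f' f'' (q x)) (hq : ContDiffAt ℝ 2 q x) :
    ndiv A (fun y => f (q y)) x =
      f' (q x) * ndiv A q x + f'' * coForm A x (fderiv ℝ q x) (fderiv ℝ q x) := by
  have h1 : fderiv ℝ (fun y => f (q y)) x = f' (q x) • fderiv ℝ q x :=
    ((hf (q x)).comp_hasFDerivAt x (hq.differentiableAt (by norm_num)).hasFDerivAt).fderiv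
  simp only [ndiv, coForm, h1, fderiv_fderiv_comp hf hf' hq, Finset.mul_sum,
    ← Finset.sum_add_distrib]
  refine Finset.sum_congr rfl fun i _ => Finset.sum_congr rfl fun j _ => ?_
  simp
  ring

theorem coForm_comm (hA : (A x).IsSymm) (p q : EuclideanSpace ℝ (Fin d) →L[ℝ] ℝ) :
    coForm A x p q = coForm A x q p := by
  rw [coForm, Finset.sum_comm]
  refine Finset.sum_congr rfl fun i _ => Finset.sum_congr rfl fun j _ => ?_
  rw [hA.apply i j]
  ring

theorem ndiv_mul {u g : EuclideanSpace ℝ (Fin d) → ℝ} (hA : (A x).IsSymm)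
    (hu : ContDiffAt ℝ 2 u x) (hg : ContDiffAt ℝ 2 g x) :
    ndiv A (fun y => u y * g y) x =
      u x * ndiv A g x + g x * ndiv A u x + 2 * coForm A x (fderiv ℝ u x) (fderiv ℝ g x) := by
  have h1 : fderiv ℝ (fun y => u y * g y) x = u x • fderiv ℝ g x + g x • fderiv ℝ u x :=
    ((hu.differentiableAt (by norm_num)).hasFDerivAt.mul
      (hg.differentiableAt (by norm_num)).hasFDerivAt).fderiv
  rw [two_mul]
  nth_rewrite 2 [coForm_comm hA]
  simp only [ndiv, coForm, h1, fderiv_fderiv_mul hu hg, Finset.mul_sum,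
    ← Finset.sum_add_distrib]
  refine Finset.sum_congr rfl fun i _ => Finset.sum_congr rfl fun j _ => ?_
  simp
  ring

theorem ndiv_sub_const_mul {u h : EuclideanSpace ℝ (Fin d) → ℝ} (c : ℝ)
    (hu : ContDiffAt ℝ 2 u x) (hh : ContDiffAt ℝ 2 h x) :
    ndiv A (fun y => u y - c * h y) x = ndiv A u x - c * ndiv A h x := by
  have h1 : fderiv ℝ (fun y => u y - c * h y) x = fderiv ℝ u x - c • fderiv ℝ h x :=
    ((hu.differentiableAt (by norm_num)).hasFDerivAt.sub
      ((hh.differentiableAt (by norm_num)).hasFDerivAt.const_mul c)).fderiv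
  simp only [ndiv, h1, fderiv_fderiv_sub_const_mul c hu hh, Finset.mul_sum,
    ← Finset.sum_sub_distrib]
  refine Finset.sum_congr rfl fun i _ => Finset.sum_congr rfl fun j _ => ?_
  simp
  ring

theorem continuousOn_ndiv (hΩo : IsOpen Ω) (hA : ∀ i j, ContDiffOn ℝ 1 (fun x => A x i j) Ω)
    {u : EuclideanSpace ℝ (Fin d) → ℝ} (hu : ContDiffOn ℝ 2 u Ω) :
    ContinuousOn (ndiv A u) Ω := by
  have hDu : ContDiffOn ℝ 1 (fderiv ℝ u) Ω := hu.fderiv_of_isOpen hΩo (by norm_num)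
  have hDDu : ContinuousOn (fderiv ℝ (fderiv ℝ u)) Ω :=
    hDu.continuousOn_fderiv_of_isOpen hΩo (by norm_num)
  refine continuousOn_finsetSum _ fun i _ => continuousOn_finsetSum _ fun j _ => ?_
  exact ((((hA i j).continuousOn_fderiv_of_isOpen hΩo (by norm_num)).clm_apply
    continuousOn_const).mul (hDu.continuousOn.clm_apply continuousOn_const)).add
    ((hA i j).continuousOn.mul ((hDDu.clm_apply continuousOn_const).clm_apply continuousOn_const))

theorem Lop_congr {u v : EuclideanSpace ℝ (Fin d) → ℝ} (h : u =ᶠ[𝓝 x] v) :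
    Lop A V u x = Lop A V v x := by
  have h1 : ∀ i, (fun y => ∑ j, A y i j * gradient u y j) =ᶠ[𝓝 x]
      fun y => ∑ j, A y i j * gradient v y j := fun i =>
    h.eventuallyEq_nhds.mono fun y hy => by simp only [gradient, hy.fderiv_eq]
  simp only [Lop, (h1 _).fderiv_eq, h.eq_of_nhds]

/-- Pointwise positivity of `A` expressed on covectors. -/
theorem le_coForm {c : ℝ} (h : ∀ ξ : EuclideanSpace ℝ (Fin d),
    c * ‖ξ‖ ^ 2 ≤ ∑ i, ∑ j, A x i j * ξ i * ξ j) (p : EuclideanSpace ℝ (Fin d) →L[ℝ] ℝ) :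
    c * ‖p‖ ^ 2 ≤ coForm A x p p := by
  have key : ∀ j, (InnerProductSpace.toDual ℝ _).symm p j = p (stdVec j) := fun j => by
    conv_rhs => rw [← (InnerProductSpace.toDual ℝ _).apply_symm_apply p]
    rw [InnerProductSpace.toDual_apply_apply, stdVec, EuclideanSpace.inner_single_right]
    simp
  have := h ((InnerProductSpace.toDual ℝ _).symm p)
  simpa only [coForm, key, LinearIsometryEquiv.norm_map] using this

end NondivergenceForm

section PositivePartPower

theorem hasDerivAt_max_zero_pow (n : ℕ) (t : ℝ) :
    HasDerivAt (fun t : ℝ => max t 0 ^ (n + 2)) ((n + 2) * max t 0 ^ (n + 1)) t := by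
  rcases lt_trichotomy t 0 with ht | rfl | ht
  · have h : (fun t : ℝ => max t 0 ^ (n + 2)) =ᶠ[𝓝 t] fun _ => 0 := by
      filter_upwards [eventually_lt_nhds ht] with s hs
      simp [max_eq_right hs.le]
    simpa [max_eq_right ht.le] using (hasDerivAt_const t (0 : ℝ)).congr_of_eventuallyEq h
  · have h : (fun t : ℝ => max t 0 ^ (n + 2)) =O[𝓝 0] fun t => ‖t - 0‖ ^ (n + 2) := by
      refine Asymptotics.IsBigO.of_bound 1 (Eventually.of_forall fun t => ?_)
      simp only [sub_zero, norm_pow, norm_norm, one_mul]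
      refine pow_le_pow_left₀ (norm_nonneg _) ?_ _
      rw [Real.norm_of_nonneg (le_max_right _ _)]
      exact max_le (le_abs_self t) (abs_nonneg t)
    simpa using (h.hasFDerivAt (by omega)).hasDerivAt
  · have h : (fun t : ℝ => max t 0 ^ (n + 2)) =ᶠ[𝓝 t] fun t => t ^ (n + 2) := by
      filter_upwards [eventually_gt_nhds ht] with s hs
      simp [max_eq_left hs.le]
    simpa [max_eq_left ht.le] using (hasDerivAt_pow (n + 2) t).congr_of_eventuallyEq h

theorem contDiff_two_max_zero_pow (n : ℕ) : ContDiff ℝ 2 (fun t : ℝ => max t 0 ^ (n + 3)) := by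
  have h1 : deriv (fun t : ℝ => max t 0 ^ (n + 3)) =
      fun t => ((n + 1 : ℕ) + 2 : ℝ) * max t 0 ^ (n + 2) :=
    funext fun t => (hasDerivAt_max_zero_pow (n + 1) t).deriv
  have h2 := fun t => (hasDerivAt_max_zero_pow n t).const_mul ((n + 1 : ℕ) + 2 : ℝ)
  rw [show (2 : WithTop ℕ∞) = 1 + 1 by norm_num, contDiff_succ_iff_deriv, h1,
    contDiff_one_iff_deriv]
  refine ⟨fun t => (hasDerivAt_max_zero_pow (n + 1) t).differentiableAt, by simp,
    fun t => (h2 t).differentiableAt, ?_⟩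
  rw [funext fun t => (h2 t).deriv]
  fun_prop

end PositivePartPower

section Supersolutions

variable {d : ℕ} {A : EuclideanSpace ℝ (Fin d) → Matrix (Fin d) (Fin d) ℝ}
  {V : EuclideanSpace ℝ (Fin d) → ℝ} {Ω : Set (EuclideanSpace ℝ (Fin d))}

/-- `w` is a positive classical supersolution of `Lu = 0` on `Ω`. -/
structure IsPosSuper {d : ℕ} (A : EuclideanSpace ℝ (Fin d) → Matrix (Fin d) (Fin d) ℝ)
    (V : EuclideanSpace ℝ (Fin d) → ℝ) (Ω : Set (EuclideanSpace ℝ (Fin d)))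
    (w : EuclideanSpace ℝ (Fin d) → ℝ) : Prop where
  contDiffOn : ContDiffOn ℝ 2 w Ω
  pos : ∀ x ∈ Ω, 0 < w x
  nonneg : ∀ x ∈ Ω, 0 ≤ Lop A V w x

theorem Lop_eq_of_mem (hΩo : IsOpen Ω) (hA : ∀ i j, ContDiffOn ℝ 1 (fun x => A x i j) Ω)
    {u : EuclideanSpace ℝ (Fin d) → ℝ} {x : EuclideanSpace ℝ (Fin d)} (hx : x ∈ Ω)
    (hu : ContDiffAt ℝ 2 u x) : Lop A V u x = -ndiv A u x + V x * u x :=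
  Lop_eq_ndiv (fun i j => ((hA i j).contDiffAt (hΩo.mem_nhds hx)).differentiableAt (by norm_num)) hu

theorem continuousOn_Lop (hΩo : IsOpen Ω) (hA : ∀ i j, ContDiffOn ℝ 1 (fun x => A x i j) Ω)
    (hV : ContinuousOn V Ω) {u : EuclideanSpace ℝ (Fin d) → ℝ} (hu : ContDiffOn ℝ 2 u Ω) :
    ContinuousOn (Lop A V u) Ω :=
  ((continuousOn_ndiv hΩo hA hu).neg.add (hV.mul hu.continuousOn)).congr fun _ hx =>
    Lop_eq_of_mem hΩo hA hx (hu.contDiffAt (hΩo.mem_nhds hx))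

/-- Strict positivity of `Lw` at the centre of a ball propagates to the whole ball, using the
barrier `(R² - |x - a|²)₊ ^ n` for large `n`. -/
theorem exists_isPosSuper_pos_of_mem_ball (hΩo : IsOpen Ω)
    (hA : ∀ i j, ContDiffOn ℝ 1 (fun x => A x i j) Ω) (hV : ContinuousOn V Ω)
    {a : EuclideanSpace ℝ (Fin d)} {R lam : ℝ} (hR : 0 < R) (hball : Metric.closedBall a R ⊆ Ω)
    (hlam : 0 < lam) (hell : ∀ x ∈ Metric.closedBall a R, ∀ ξ : EuclideanSpace ℝ (Fin d),
      lam * ‖ξ‖ ^ 2 ≤ ∑ i, ∑ j, A x i j * ξ i * ξ j)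
    {w : EuclideanSpace ℝ (Fin d) → ℝ} (hw : IsPosSuper A V Ω w) (ha : 0 < Lop A V w a) :
    ∃ w', IsPosSuper A V Ω w' ∧ ∀ x ∈ Metric.ball a R, 0 < Lop A V w' x := by
  have hK := isCompact_closedBall a R
  have haK : a ∈ Metric.closedBall a R := Metric.mem_closedBall_self hR.le
  obtain ⟨r, hr, hrm⟩ : ∃ r > 0, ∀ y ∈ Metric.closedBall a r, Lop A V w a / 2 < Lop A V w y := by
    have := ((continuousOn_Lop hΩo hA hV hw.contDiffOn).continuousAt
      (hΩo.mem_nhds (hball haK))).eventually_const_lt (half_lt_self ha)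
    exact Metric.nhds_basis_closedBall.eventually_iff.1 this
  set ψ : EuclideanSpace ℝ (Fin d) → ℝ := fun y => R ^ 2 - ‖y - a‖ ^ 2 with hψ
  have hψC : ContDiff ℝ 2 ψ := contDiff_const.sub ((contDiff_id.sub contDiff_const).norm_sq ℝ)
  have hψR : ∀ y, ψ y ≤ R ^ 2 := fun y => sub_le_self _ (sq_nonneg _)
  have hψK : ∀ y, 0 < ψ y ↔ y ∈ Metric.ball a R := fun y => by
    rw [mem_ball_iff_norm, hψ, sub_pos, sq_lt_sq₀ (norm_nonneg _) hR.le]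
  have hDψ : ∀ y, ‖fderiv ℝ ψ y‖ = 2 * ‖y - a‖ := fun y => by
    have h : HasFDerivAt ψ _ y := ((((hasFDerivAt_id y).sub_const a)).norm_sq).const_sub (R ^ 2)
    rw [h.fderiv, norm_neg, ContinuousLinearMap.comp_id, ← Nat.cast_smul_eq_nsmul ℝ, norm_smul,
      innerSL_apply_norm]
    simp
  obtain ⟨C₁, hC₁⟩ := hK.exists_bound_of_continuousOn
    ((continuousOn_ndiv hΩo hA hψC.contDiffOn).mono hball)
  obtain ⟨C₂, hC₂⟩ := hK.exists_bound_of_continuousOn (hV.mono hball)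
  have hC₁0 : 0 ≤ C₁ := (norm_nonneg _).trans (hC₁ a haK)
  have hC₂0 : 0 ≤ C₂ := (norm_nonneg _).trans (hC₂ a haK)
  set β := lam * (2 * r) ^ 2 with hβ
  have hβ0 : 0 < β := by positivity
  obtain ⟨n, hn⟩ := exists_nat_gt ((R ^ 2 * C₁ + C₂ * (R ^ 2) ^ 2) / β)
  rw [div_lt_iff₀ hβ0] at hn
  set h : EuclideanSpace ℝ (Fin d) → ℝ := fun y => max (ψ y) 0 ^ (n + 3) with hh
  have hhC : ContDiff ℝ 2 h := (contDiff_two_max_zero_pow n).comp hψC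
  have hLh : ∀ y ∈ Ω, Lop A V h y = -((n + 3) * max (ψ y) 0 ^ (n + 2) * ndiv A ψ y +
      (n + 3) * ((n + 2) * max (ψ y) 0 ^ (n + 1)) *
        coForm A y (fderiv ℝ ψ y) (fderiv ℝ ψ y)) + V y * max (ψ y) 0 ^ (n + 3) := fun y hy => by
    have hf : ∀ t : ℝ, HasDerivAt (fun t : ℝ => max t 0 ^ (n + 3))
        ((n + 3) * max t 0 ^ (n + 2)) t := fun t => by
      convert hasDerivAt_max_zero_pow (n + 1) t using 2
      push_cast
      ring
    rw [Lop_eq_of_mem hΩo hA hy hhC.contDiffAt, hh,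
      ndiv_comp hf ((hasDerivAt_max_zero_pow n _).const_mul _) hψC.contDiffAt]
  have hLh0 : ∀ y ∈ Ω, y ∉ Metric.ball a R → h y = 0 ∧ Lop A V h y = 0 := fun y hy hyR => by
    have h0 : max (ψ y) 0 = 0 := max_eq_right (not_lt.1 (mt (hψK y).1 hyR))
    exact ⟨by simp [hh, h0], by rw [hLh y hy]; simp [h0]⟩
  have hLhneg : ∀ y ∈ Metric.ball a R, r < ‖y - a‖ → Lop A V h y < 0 := fun y hy hyr => by
    have hyK := Metric.ball_subset_closedBall hy
    have hp := (hψK y).2 hy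
    rw [hLh y (hball hyK), max_eq_left hp.le]
    have hco : β ≤ coForm A y (fderiv ℝ ψ y) (fderiv ℝ ψ y) := by
      refine le_trans ?_ (le_coForm (hell y hyK) _)
      rw [hDψ, hβ]
      gcongr
    have h1 : -(R ^ 2 * C₁) ≤ ψ y * ndiv A ψ y := by
      have : |ψ y * ndiv A ψ y| ≤ R ^ 2 * C₁ := by
        rw [abs_mul, abs_of_pos hp]
        exact mul_le_mul (hψR y) (hC₁ y hyK) (abs_nonneg _) (by positivity)
      exact (abs_le.1 this).1
    have h2 : V y * ψ y ^ 2 ≤ C₂ * (R ^ 2) ^ 2 :=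
      mul_le_mul ((le_abs_self _).trans (hC₂ y hyK)) (pow_le_pow_left₀ hp.le (hψR y) 2)
        (by positivity) hC₂0
    have hn0 : (0 : ℝ) ≤ n := n.cast_nonneg
    have h3 : V y * ψ y ^ 2 <
        (n + 3) * (ψ y * ndiv A ψ y) + (n + 3) * (n + 2) *
          coForm A y (fderiv ℝ ψ y) (fderiv ℝ ψ y) := by
      have h4 : (n + 3) * -(R ^ 2 * C₁) ≤ (n + 3) * (ψ y * ndiv A ψ y) := by gcongr
      have h5 : ((n : ℝ) + 3) * (n + 2) * β ≤ (n + 3) * (n + 2) *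
          coForm A y (fderiv ℝ ψ y) (fderiv ℝ ψ y) := by gcongr
      have h6 : 0 ≤ C₂ * (R ^ 2) ^ 2 := by positivity
      nlinarith [mul_pos (show (0 : ℝ) < n + 3 by positivity) (sub_pos.2 hn),
        mul_nonneg hn0 h6, mul_nonneg hn0 hβ0.le]
    have := mul_lt_mul_of_pos_left h3 (pow_pos hp (n + 1))
    rw [pow_add (ψ y) n 3, pow_add (ψ y) n 2]
    rw [pow_add (ψ y) n 1] at this ⊢
    linarith
  obtain ⟨C₃, hC₃⟩ := hK.exists_bound_of_continuousOn
    ((continuousOn_Lop hΩo hA hV hhC.contDiffOn).mono hball)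
  obtain ⟨F, hF⟩ := hK.exists_bound_of_continuousOn hhC.continuous.continuousOn
  have hC₃0 : 0 ≤ C₃ := (norm_nonneg _).trans (hC₃ a haK)
  have hF0 : 0 ≤ F := (norm_nonneg _).trans (hF a haK)
  obtain ⟨z, hz, hzmin⟩ := hK.exists_isMinOn ⟨a, haK⟩ (hw.contDiffOn.continuousOn.mono hball)
  have hz0 := hw.pos z (hball hz)
  obtain ⟨δ, hδ, hδ₃, hδF⟩ : ∃ δ > 0, δ * C₃ < Lop A V w a / 2 ∧ δ * F < w z := by
    refine ⟨min (Lop A V w a / 2 / (C₃ + 1)) (w z / (F + 1)), by positivity, ?_, ?_⟩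
    · refine (mul_le_mul_of_nonneg_right (min_le_left _ _) hC₃0).trans_lt ?_
      rw [div_mul_eq_mul_div, div_lt_iff₀ (by positivity)]
      nlinarith
    · refine (mul_le_mul_of_nonneg_right (min_le_right _ _) hF0).trans_lt ?_
      rw [div_mul_eq_mul_div, div_lt_iff₀ (by positivity)]
      nlinarith
  have hLw' : ∀ y ∈ Ω, Lop A V (fun y => w y - δ * h y) y = Lop A V w y - δ * Lop A V h y :=
    fun y hy => by
      have hwy := hw.contDiffOn.contDiffAt (hΩo.mem_nhds hy)
      rw [Lop_eq_of_mem hΩo hA hy (hwy.sub (contDiffAt_const.mul hhC.contDiffAt)),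
        Lop_eq_of_mem hΩo hA hy hwy, Lop_eq_of_mem hΩo hA hy hhC.contDiffAt,
        ndiv_sub_const_mul δ hwy hhC.contDiffAt]
      ring
  have hpos : ∀ y ∈ Metric.ball a R, 0 < Lop A V (fun y => w y - δ * h y) y := fun y hy => by
    have hyK := Metric.ball_subset_closedBall hy
    rw [hLw' y (hball hyK)]
    rcases le_or_gt ‖y - a‖ r with hyr | hyr
    · have h1 := hrm y (mem_closedBall_iff_norm.2 hyr)
      have h2 := mul_le_mul_of_nonneg_left ((le_abs_self _).trans (hC₃ y hyK)) hδ.le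
      linarith
    · have h1 := hw.nonneg y (hball hyK)
      have h2 := mul_neg_of_pos_of_neg hδ (hLhneg y hy hyr)
      linarith
  refine ⟨fun y => w y - δ * h y, ⟨hw.contDiffOn.sub (contDiffOn_const.mul hhC.contDiffOn),
    fun y hy => ?_, fun y hy => ?_⟩, hpos⟩
  · by_cases hyR : y ∈ Metric.ball a R
    · have hyK := Metric.ball_subset_closedBall hyR
      have h1 := mul_le_mul_of_nonneg_left ((le_abs_self _).trans (hF y hyK)) hδ.le
      have h2 : w z ≤ w y := hzmin hyK
      linarith
    · simpa [(hLh0 y hy hyR).1] using hw.pos y hy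
  · by_cases hyR : y ∈ Metric.ball a R
    · exact (hpos y hyR).le
    · simpa [hLw' y hy, (hLh0 y hy hyR).2] using hw.nonneg y hy

/-- Termwise differentiation on a ball of a weighted series with uniformly bounded terms. -/
theorem exists_hasFDerivAt_tsum_smul {E G : Type*} [NormedAddCommGroup E] [NormedSpace ℝ E]
    [NormedAddCommGroup G] [NormedSpace ℝ G] [CompleteSpace G] {f : ℕ → E → G}
    {f' : ℕ → E → E →L[ℝ] G} {c M : ℕ → ℝ} {x : E} {ε : ℝ} (hc : ∀ n, 0 ≤ c n)
    (hS : Summable fun n => c n * M n)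
    (hf : ∀ n, ∀ y ∈ Metric.ball x ε, HasFDerivAt (f n) (f' n y) y)
    (hf' : ∀ n, ContinuousOn (f' n) (Metric.ball x ε))
    (hM : ∀ n, ∀ y ∈ Metric.ball x ε, ‖f n y‖ ≤ M n)
    (hM' : ∀ n, ∀ y ∈ Metric.ball x ε, ‖f' n y‖ ≤ M n) :
    ∃ D : E → E →L[ℝ] G, ContinuousOn D (Metric.ball x ε) ∧ ∀ y ∈ Metric.ball x ε,
      HasFDerivAt (fun y => ∑' n, c n • f n y) (D y) y ∧ D y = ∑' n, c n • f' n y ∧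
      HasSum (fun n => c n • f n y) (∑' n, c n • f n y) ∧
      ∀ p, HasSum (fun n => c n • f' n y p) (D y p) := by
  have hb : ∀ n, ∀ y ∈ Metric.ball x ε, ‖c n • f n y‖ ≤ c n * M n := fun n y hy => by
    rw [norm_smul, Real.norm_of_nonneg (hc n)]
    exact mul_le_mul_of_nonneg_left (hM n y hy) (hc n)
  have hb' : ∀ n, ∀ y ∈ Metric.ball x ε, ‖c n • f' n y‖ ≤ c n * M n := fun n y hy => by
    rw [norm_smul, Real.norm_of_nonneg (hc n)]
    exact mul_le_mul_of_nonneg_left (hM' n y hy) (hc n)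
  have s : ∀ y ∈ Metric.ball x ε, Summable fun n => c n • f n y := fun y hy =>
    .of_norm_bounded hS fun n => hb n y hy
  have s' : ∀ y ∈ Metric.ball x ε, Summable fun n => c n • f' n y := fun y hy =>
    .of_norm_bounded hS fun n => hb' n y hy
  exact ⟨fun y => ∑' n, c n • f' n y,
    continuousOn_tsum (fun n => (hf' n).const_smul (c n)) hS hb', fun y hy =>
    ⟨hasFDerivAt_tsum_of_isPreconnected hS Metric.isOpen_ball (convex_ball x ε).isPreconnected
        (fun n z hz => (hf n z hz).const_smul (c n)) hb' hy (s y hy) hy,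
      rfl, (s y hy).hasSum, fun p => (s' y hy).hasSum.mapL (ContinuousLinearMap.apply ℝ G p)⟩⟩

/-- A countable family of `C²` functions on an open set has positive weights for which the
weighted sum is `C²` and can be differentiated twice term by term. -/
theorem exists_hasSum_contDiffAt_two {E : Type*} [NormedAddCommGroup E] [NormedSpace ℝ E]
    [ProperSpace E] {Ω : Set E} (hΩo : IsOpen Ω) {w : ℕ → E → ℝ}
    (hw : ∀ n, ContDiffOn ℝ 2 (w n) Ω) :
    ∃ c : ℕ → ℝ, (∀ n, 0 < c n) ∧ ∃ u : E → ℝ, ∀ x ∈ Ω, ContDiffAt ℝ 2 u x ∧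
      HasSum (fun n => c n * w n x) (u x) ∧
      (∀ p, HasSum (fun n => c n * fderiv ℝ (w n) x p) (fderiv ℝ u x p)) ∧
      ∀ p p', HasSum (fun n => c n * fderiv ℝ (fderiv ℝ (w n)) x p p')
        (fderiv ℝ (fderiv ℝ u) x p p') := by
  have : LocallyCompactSpace Ω := hΩo.locallyCompactSpace
  let K : CompactExhaustion Ω := default
  have hKc : ∀ j, IsCompact (Subtype.val '' K j) := fun j =>
    (K.isCompact j).image continuous_subtype_val
  have hKΩ : ∀ j, Subtype.val '' K j ⊆ Ω := fun j => by
    rintro _ ⟨y, -, rfl⟩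
    exact y.2
  have hw1 : ∀ n, ContDiffOn ℝ 1 (fderiv ℝ (w n)) Ω := fun n =>
    (hw n).fderiv_of_isOpen hΩo (by norm_num)
  have hw2 : ∀ n, ContinuousOn (fderiv ℝ (fderiv ℝ (w n))) Ω := fun n =>
    (hw1 n).continuousOn_fderiv_of_isOpen hΩo (by norm_num)
  have hM : ∀ n j, ∃ M : ℝ, 0 ≤ M ∧ ∀ y ∈ Subtype.val '' K j, ‖w n y‖ ≤ M ∧
      ‖fderiv ℝ (w n) y‖ ≤ M ∧ ‖fderiv ℝ (fderiv ℝ (w n)) y‖ ≤ M := fun n j => by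
    obtain ⟨M₀, h₀⟩ := (hKc j).exists_bound_of_continuousOn
      ((hw n).continuousOn.mono (hKΩ j))
    obtain ⟨M₁, h₁⟩ := (hKc j).exists_bound_of_continuousOn ((hw1 n).continuousOn.mono (hKΩ j))
    obtain ⟨M₂, h₂⟩ := (hKc j).exists_bound_of_continuousOn (E := E →L[ℝ] E →L[ℝ] ℝ)
      ((hw2 n).mono (hKΩ j))
    refine ⟨max 0 (max M₀ (max M₁ M₂)), le_max_left _ _, fun y hy => ⟨?_, ?_, ?_⟩⟩
    · exact (h₀ y hy).trans (by simp)
    · exact (h₁ y hy).trans (by simp)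
    · exact (h₂ y hy).trans (by simp)
  choose M hM0 hM using hM
  let c : ℕ → ℝ := fun n => (1 / 2) ^ n / (1 + ∑ j ∈ Finset.range (n + 1), M n j)
  have hden : ∀ n, 0 < 1 + ∑ j ∈ Finset.range (n + 1), M n j := fun n =>
    add_pos_of_pos_of_nonneg one_pos (Finset.sum_nonneg fun j _ => hM0 n j)
  have hc : ∀ n, 0 < c n := fun n => div_pos (by positivity) (hden n)
  have hS : ∀ j, Summable fun n => c n * M n j := fun j => by
    refine .of_norm_bounded_eventually_nat summable_geometric_two ?_
    filter_upwards [eventually_ge_atTop j] with n hn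
    rw [Real.norm_of_nonneg (mul_nonneg (hc n).le (hM0 n j)), div_mul_eq_mul_div,
      div_le_iff₀ (hden n)]
    gcongr
    have := Finset.single_le_sum (f := M n) (fun j _ => hM0 n j)
      (Finset.mem_range.2 (Nat.lt_succ_of_le hn))
    linarith
  set u : E → ℝ := fun y => ∑' n, c n • w n y with hu
  suffices key : ∀ x ∈ Ω, ContDiffAt ℝ 2 u x ∧ HasSum (fun n => c n * w n x) (u x) ∧
      (∀ p, HasSum (fun n => c n * fderiv ℝ (w n) x p) (fderiv ℝ u x p)) ∧
      ∀ p p', HasSum (fun n => c n * fderiv ℝ (fderiv ℝ (w n)) x p p')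
        (fderiv ℝ (fderiv ℝ u) x p p') from ⟨c, hc, u, key⟩
  intro x hx
  obtain ⟨j, hj⟩ : ∃ j, Subtype.val '' K j ∈ 𝓝 x := by
    obtain ⟨j, hj⟩ := K.exists_mem_nhds ⟨x, hx⟩
    exact ⟨j, hΩo.isOpenMap_subtype_val.image_mem_nhds hj⟩
  obtain ⟨ε, hε, hB⟩ := Metric.mem_nhds_iff.1 hj
  have hxB : x ∈ Metric.ball x ε := Metric.mem_ball_self hε
  have hBΩ : Metric.ball x ε ⊆ Ω := hB.trans (hKΩ j)
  have hwat : ∀ n, ∀ y ∈ Metric.ball x ε, ContDiffAt ℝ 2 (w n) y := fun n y hy =>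
    (hw n).contDiffAt (hΩo.mem_nhds (hBΩ hy))
  obtain ⟨D₁, -, hD1⟩ := exists_hasFDerivAt_tsum_smul (fun n => (hc n).le) (hS j)
    (fun n y hy => ((hwat n y hy).differentiableAt (by norm_num)).hasFDerivAt)
    (fun n => (hw1 n).continuousOn.mono hBΩ) (fun n y hy => (hM n j y (hB hy)).1)
    fun n y hy => (hM n j y (hB hy)).2.1
  obtain ⟨D₂, hD₂c, hD2⟩ := exists_hasFDerivAt_tsum_smul (fun n => (hc n).le) (hS j)
    (fun n y hy => (hwat n y hy).hasFDerivAt_fderiv)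
    (fun n => (hw2 n).mono hBΩ) (fun n y hy => (hM n j y (hB hy)).2.1)
    fun n y hy => (hM n j y (hB hy)).2.2
  have hu1 : ∀ y ∈ Metric.ball x ε, HasFDerivAt u (D₁ y) y := fun y hy => (hD1 y hy).1
  have hu2 : ∀ y ∈ Metric.ball x ε, HasFDerivAt (fderiv ℝ u) (D₂ y) y := fun y hy =>
    (hD2 y hy).1.congr_of_eventuallyEq <|
      eventually_of_mem (Metric.isOpen_ball.mem_nhds hy) fun z hz =>
        (hu1 z hz).fderiv.trans (hD1 z hz).2.1
  have hD2c : ContinuousOn (fderiv ℝ (fderiv ℝ u)) (Metric.ball x ε) :=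
    hD₂c.congr fun y hy => (hu2 y hy).fderiv
  have hC1 : ContDiffOn ℝ 1 (fderiv ℝ u) (Metric.ball x ε) := by
    rw [show (1 : WithTop ℕ∞) = 0 + 1 by norm_num,
      contDiffOn_succ_iff_fderiv_of_isOpen Metric.isOpen_ball]
    exact ⟨fun y hy => (hu2 y hy).differentiableAt.differentiableWithinAt, by simp,
      contDiffOn_zero.2 hD2c⟩
  have hC2 : ContDiffOn ℝ 2 u (Metric.ball x ε) := by
    rw [show (2 : WithTop ℕ∞) = 1 + 1 by norm_num,
      contDiffOn_succ_iff_fderiv_of_isOpen Metric.isOpen_ball]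
    exact ⟨fun y hy => (hu1 y hy).differentiableAt.differentiableWithinAt, by simp, hC1⟩
  refine ⟨hC2.contDiffAt (Metric.isOpen_ball.mem_nhds hxB), (hD1 x hxB).2.2.1, fun p => ?_,
    fun p p' => ?_⟩
  · rw [(hu1 x hxB).fderiv]
    exact (hD1 x hxB).2.2.2 p
  · rw [(hu2 x hxB).fderiv]
    exact ((hD2 x hxB).2.2.2 p).mapL (ContinuousLinearMap.apply ℝ ℝ p')

/-- A suitably weighted countable sum of positive supersolutions is a positive supersolution,
strict wherever one of the summands is. -/
theorem exists_isPosSuper_of_seq (hΩo : IsOpen Ω)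
    (hA : ∀ i j, ContDiffOn ℝ 1 (fun x => A x i j) Ω)
    {w : ℕ → EuclideanSpace ℝ (Fin d) → ℝ} (hw : ∀ n, IsPosSuper A V Ω (w n)) :
    ∃ u, IsPosSuper A V Ω u ∧ ∀ x ∈ Ω, (∃ n, 0 < Lop A V (w n) x) → 0 < Lop A V u x := by
  obtain ⟨c, hc, u, key⟩ := exists_hasSum_contDiffAt_two hΩo fun n => (hw n).contDiffOn
  have hL : ∀ x ∈ Ω, HasSum (fun n => c n * Lop A V (w n) x) (Lop A V u x) := by
    intro x hx
    obtain ⟨hC, h0, h1', h2'⟩ := key x hx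
    rw [Lop_eq_of_mem hΩo hA hx hC]
    have h3 : HasSum (fun n => c n * ndiv A (w n) x) (ndiv A u x) := by
      refine (hasSum_sum fun i _ => hasSum_sum fun j _ =>
        ((h1' (stdVec j)).mul_left (fderiv ℝ (fun y => A y i j) x (stdVec i))).add
          ((h2' (stdVec i) (stdVec j)).mul_left (A x i j))).congr_fun fun n => ?_
      simp only [ndiv, Finset.mul_sum]
      refine Finset.sum_congr rfl fun i _ => Finset.sum_congr rfl fun j _ => ?_
      ring
    refine (h3.neg.add (h0.mul_left (V x))).congr_fun fun n => ?_
    rw [Lop_eq_of_mem hΩo hA hx ((hw n).contDiffOn.contDiffAt (hΩo.mem_nhds hx))]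
    ring
  have hLn : ∀ x ∈ Ω, ∀ n, 0 ≤ c n * Lop A V (w n) x := fun x hx n =>
    mul_nonneg (hc n).le ((hw n).nonneg x hx)
  refine ⟨u, ⟨fun x hx => (key x hx).1.contDiffWithinAt, fun x hx => ?_, fun x hx =>
    (hL x hx).nonneg (hLn x hx)⟩, fun x hx ⟨n, hn⟩ => ?_⟩
  · have h := fun n => mul_pos (hc n) ((hw n).pos x hx)
    exact (h 0).trans_le (le_hasSum (key x hx).2.1 0 fun n _ => (h n).le)
  · exact (mul_pos (hc n) hn).trans_le (le_hasSum (hL x hx) n fun m _ => hLn x hx m)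

/-- If `φ` is a positive solution which is not of minimal growth at infinity, then there is a
positive supersolution which is strict at some point. -/
theorem exists_isPosSuper_pos_of_not_hasMinimalGrowth (hΩo : IsOpen Ω) (hΩc : IsConnected Ω)
    (hA : ∀ i j, ContDiffOn ℝ 1 (fun x => A x i j) Ω) (hAsymm : ∀ x ∈ Ω, (A x).IsSymm)
    (hell : ∀ x ∈ Ω, ∃ c > 0, ∀ ξ : EuclideanSpace ℝ (Fin d),
      c * ‖ξ‖ ^ 2 ≤ ∑ i, ∑ j, A x i j * ξ i * ξ j)
    {φ : EuclideanSpace ℝ (Fin d) → ℝ} (hφ : IsPosSolutionOn A V φ Ω)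
    (hmg : ¬ HasMinimalGrowthAtInfinity Ω A V φ) :
    ∃ w, IsPosSuper A V Ω w ∧ ∃ x ∈ Ω, 0 < Lop A V w x := by
  classical
  obtain ⟨hφC, hφ0, hφL⟩ := hφ
  simp only [HasMinimalGrowthAtInfinity, not_forall, not_le] at hmg
  obtain ⟨K₁, hKo, ⟨z, hz⟩, -, hKΩ, v, hvc, ⟨hvC, hv0, hvL⟩, hle, x₀, hx₀, hlt⟩ := hmg
  have hUo : IsOpen (Ω \ closure K₁) := hΩo.sdiff isClosed_closure
  have hfr : ∀ x ∈ Ω, x ∉ K₁ → x ∉ Ω \ closure K₁ → x ∈ frontier K₁ := fun x hx hxK hxU =>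
    ⟨by_contra fun h => hxU ⟨hx, h⟩, by rwa [hKo.interior_eq]⟩
  have hx₀U : x₀ ∈ Ω \ closure K₁ :=
    by_contra fun h => hlt.not_ge (hle x₀ (hfr x₀ hx₀.1 hx₀.2 h))
  obtain ⟨θ, hθ1, hθ2⟩ := exists_between ((div_lt_one (hφ0 x₀ hx₀.1)).2 hlt)
  set q : EuclideanSpace ℝ (Fin d) → ℝ := fun x => v x / φ x with hq
  set g : EuclideanSpace ℝ (Fin d) → ℝ := fun x => 1 - max (θ - q x) 0 ^ (0 + 3) with hg
  set u : EuclideanSpace ℝ (Fin d) → ℝ := fun x => if x ∈ K₁ then φ x else φ x * g x with hu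
  have hφat : ∀ x ∈ Ω, ContDiffAt ℝ 2 φ x := fun x hx => hφC.contDiffAt (hΩo.mem_nhds hx)
  have huφ : ∀ x ∈ Ω, x ∉ Ω \ closure K₁ → u =ᶠ[𝓝 x] φ := by
    intro x hx hxU
    by_cases hxK : x ∈ K₁
    · filter_upwards [hKo.mem_nhds hxK] with y hy
      exact if_pos hy
    · have hvx := hle x (hfr x hx hxK hxU)
      have hc : ContinuousWithinAt q (Ω \ K₁) x :=
        ((hvc x (subset_closure ⟨hx, hxK⟩)).mono subset_closure).div
          (hφat x hx).continuousAt.continuousWithinAt (hφ0 x hx).ne'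
      have hqx : θ < q x := hθ2.trans_le ((one_le_div (hφ0 x hx)).2 hvx)
      filter_upwards [mem_nhdsWithin_iff_eventually.1 (hc.eventually_const_lt hqx),
        hΩo.mem_nhds hx] with y hy hyΩ
      by_cases hyK : y ∈ K₁
      · exact if_pos hyK
      · have : max (θ - q y) 0 = 0 := max_eq_right (sub_nonpos.2 (hy ⟨hyΩ, hyK⟩).le)
        simp [hu, hyK, hg, this]
  have hug : ∀ x ∈ Ω \ closure K₁, u =ᶠ[𝓝 x] fun x => φ x * g x := fun x hx => by
    filter_upwards [hUo.mem_nhds hx] with y hy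
    exact if_neg fun h => hy.2 (subset_closure h)
  have hqat : ∀ x ∈ Ω \ closure K₁, ContDiffAt ℝ 2 q x := fun x hx =>
    (hvC.contDiffAt (hUo.mem_nhds hx)).div (hφat x hx.1) (hφ0 x hx.1).ne'
  have hfC : ContDiff ℝ 2 (fun t : ℝ => 1 - max (θ - t) 0 ^ (0 + 3)) :=
    contDiff_const.sub ((contDiff_two_max_zero_pow 0).comp (contDiff_const.sub contDiff_id))
  have hgat : ∀ x ∈ Ω \ closure K₁, ContDiffAt ℝ 2 g x := fun x hx =>
    hfC.contDiffAt.comp x (hqat x hx)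
  have hf' : ∀ t : ℝ, HasDerivAt (fun t : ℝ => 1 - max (θ - t) 0 ^ (0 + 3))
      (3 * max (θ - t) 0 ^ 2) t := fun t => by
    have h := ((hasDerivAt_max_zero_pow 1 (θ - t)).comp t
      ((hasDerivAt_id t).const_sub θ)).const_sub 1
    exact h.congr_deriv (by norm_num)
  have hf'' : ∀ t : ℝ, HasDerivAt (fun t : ℝ => 3 * max (θ - t) 0 ^ 2)
      (-(6 * max (θ - t) 0)) t := fun t => by
    have h := ((hasDerivAt_max_zero_pow 0 (θ - t)).comp t
      ((hasDerivAt_id t).const_sub θ)).const_mul 3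
    exact h.congr_deriv (by norm_num; ring)
  have hLu : ∀ x ∈ Ω \ closure K₁, Lop A V u x =
      6 * φ x * (max (θ - q x) 0 * coForm A x (fderiv ℝ q x) (fderiv ℝ q x)) := by
    intro x hx
    have hDg : fderiv ℝ g x = (3 * max (θ - q x) 0 ^ 2) • fderiv ℝ q x :=
      ((hf' (q x)).comp_hasFDerivAt x ((hqat x hx).differentiableAt (by norm_num)).hasFDerivAt).fderiv
    have hcoS : coForm A x (fderiv ℝ φ x) (fderiv ℝ g x) =
        3 * max (θ - q x) 0 ^ 2 * coForm A x (fderiv ℝ φ x) (fderiv ℝ q x) := by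
      simp only [hDg, coForm, Finset.mul_sum]
      refine Finset.sum_congr rfl fun i _ => Finset.sum_congr rfl fun j _ => ?_
      simp
      ring
    have hvq : v =ᶠ[𝓝 x] fun y => φ y * q y := by
      filter_upwards [hΩo.mem_nhds hx.1] with y hy
      exact (mul_div_cancel₀ (v y) (hφ0 y hy).ne').symm
    have h1 := hvL x hx
    rw [Lop_congr hvq, Lop_eq_of_mem hΩo hA hx.1 ((hφat x hx.1).mul (hqat x hx)),
      ndiv_mul (hAsymm x hx.1) (hφat x hx.1) (hqat x hx)] at h1
    have h2 := hφL x hx.1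
    rw [Lop_eq_of_mem hΩo hA hx.1 (hφat x hx.1)] at h2
    rw [Lop_congr (hug x hx), Lop_eq_of_mem hΩo hA hx.1 ((hφat x hx.1).mul (hgat x hx)),
      ndiv_mul (hAsymm x hx.1) (hφat x hx.1) (hgat x hx), hcoS,
      show ndiv A g x = _ from ndiv_comp
        (f := fun t : ℝ => 1 - max (θ - t) 0 ^ (0 + 3))
        hf' (hf'' (q x)) (hqat x hx)]
    linear_combination (g x - 3 * max (θ - q x) 0 ^ 2 * q x) * h2 + 3 * max (θ - q x) 0 ^ 2 * h1
  have hco : ∀ x ∈ Ω, ∃ c > 0, ∀ p, c * ‖p‖ ^ 2 ≤ coForm A x p p := fun x hx => by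
    obtain ⟨c, hc, h⟩ := hell x hx
    exact ⟨c, hc, le_coForm h⟩
  have hg0 : ∀ x ∈ Ω \ closure K₁, 0 < g x := fun x hx => by
    have h1 : max (θ - q x) 0 < 1 := by
      have : 0 < q x := div_pos (hv0 x hx) (hφ0 x hx.1)
      exact max_lt (by linarith) one_pos
    have := pow_lt_one₀ (le_max_right (θ - q x) 0) h1 (n := 0 + 3) (by norm_num)
    exact sub_pos.2 this
  have hsuper : IsPosSuper A V Ω u := by
    refine ⟨fun x hx => ContDiffAt.contDiffWithinAt ?_, fun x hx => ?_, fun x hx => ?_⟩ <;>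
    by_cases hxU : x ∈ Ω \ closure K₁
    · exact ((hφat x hx).mul (hgat x hxU)).congr_of_eventuallyEq (hug x hxU)
    · exact (hφat x hx).congr_of_eventuallyEq (huφ x hx hxU)
    · rw [(hug x hxU).eq_of_nhds]
      exact mul_pos (hφ0 x hx) (hg0 x hxU)
    · rw [(huφ x hx hxU).eq_of_nhds]
      exact hφ0 x hx
    · obtain ⟨c, hc, h⟩ := hco x hx
      have h1 : 0 ≤ coForm A x (fderiv ℝ q x) (fderiv ℝ q x) :=
        (by positivity : 0 ≤ c * ‖fderiv ℝ q x‖ ^ 2).trans (h _)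
      have h2 := hφ0 x hx
      rw [hLu x hxU]
      positivity
    · rw [Lop_congr (huφ x hx hxU), hφL x hx]
  refine ⟨u, hsuper, by_contra fun hno => ?_⟩
  have hL0 : ∀ x ∈ Ω, Lop A V u x ≤ 0 := fun x hx => not_lt.1 fun h => hno ⟨x, hx, h⟩
  have hD : ∀ x ∈ Ω, HasFDerivAt (fun y => u y / φ y) (0 : EuclideanSpace ℝ (Fin d) →L[ℝ] ℝ) x := by
    intro x hx
    by_cases hxU : x ∈ Ω \ closure K₁
    · have hev : (fun y => u y / φ y) =ᶠ[𝓝 x] g := by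
        filter_upwards [hug x hxU, hΩo.mem_nhds hx] with y hy hyΩ
        rw [hy, mul_div_cancel_left₀ _ (hφ0 y hyΩ).ne']
      have hDg := (hf' (q x)).comp_hasFDerivAt x
        ((hqat x hxU).differentiableAt (by norm_num)).hasFDerivAt
      have hzero : (3 * max (θ - q x) 0 ^ 2) • fderiv ℝ q x = 0 := by
        rcases (le_max_right (θ - q x) 0).eq_or_lt with h0 | h0
        · simp [← h0]
        · obtain ⟨c, hc, h⟩ := hco x hx
          have h1 := hL0 x hx
          rw [hLu x hxU] at h1
          have h2 : coForm A x (fderiv ℝ q x) (fderiv ℝ q x) ≤ 0 :=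
            nonpos_of_mul_nonpos_right (nonpos_of_mul_nonpos_right h1
              (mul_pos (by norm_num) (hφ0 x hx))) h0
          have h3 : ‖fderiv ℝ q x‖ ^ 2 ≤ 0 :=
            nonpos_of_mul_nonpos_right ((h _).trans h2) hc
          have h4 : ‖fderiv ℝ q x‖ = 0 := pow_eq_zero_iff (two_ne_zero) |>.1
            (le_antisymm h3 (sq_nonneg _))
          rw [norm_eq_zero.1 h4, smul_zero]
      rw [hzero] at hDg
      exact hDg.congr_of_eventuallyEq hev
    · refine (hasFDerivAt_const (1 : ℝ) x).congr_of_eventuallyEq ?_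
      filter_upwards [huφ x hx hxU, hΩo.mem_nhds hx] with y hy hyΩ
      rw [hy, div_self (hφ0 y hyΩ).ne']
  have hzΩ : z ∈ Ω := hKΩ (subset_closure hz)
  have heq := hΩo.is_const_of_fderiv_eq_zero (𝕜 := ℝ) hΩc.isPreconnected
    (fun x hx => (hD x hx).differentiableAt.differentiableWithinAt)
    (fun x hx => (hD x hx).fderiv) hzΩ hx₀.1
  have hz1 : u z / φ z = 1 := by
    rw [show u z = φ z from if_pos hz, div_self (hφ0 z hzΩ).ne']
  have hx1 : u x₀ / φ x₀ = g x₀ := by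
    rw [show u x₀ = φ x₀ * g x₀ from if_neg hx₀.2, mul_div_cancel_left₀ _ (hφ0 x₀ hx₀.1).ne']
  have hg1 : g x₀ < 1 := by
    have : 0 < max (θ - q x₀) 0 := lt_max_of_lt_left (sub_pos.2 hθ1)
    exact sub_lt_self _ (by positivity)
  simp only [hz1, hx1] at heq
  exact hg1.ne' heq

end Supersolutions

/-- If `L` is subcritical in `Ω`, then there is a continuous `W > 0` and `λ > 0` such that
`Lu = λ W u` has a positive classical solution in `Ω`; in particular
`λ₀(L, W, Ω) > 0`. -/
theorem stmt18
    {d : ℕ} (hd : 1 ≤ d) (Ω : Set (EuclideanSpace ℝ (Fin d)))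
    (hΩo : IsOpen Ω) (hΩc : IsConnected Ω)
    (A : EuclideanSpace ℝ (Fin d) → Matrix (Fin d) (Fin d) ℝ)
    (hAsmooth : ∀ i j, ContDiffOn ℝ 1 (fun x => A x i j) Ω)
    (hAsymm : ∀ x ∈ Ω, (A x).IsSymm)
    (hAell : ∀ K : Set (EuclideanSpace ℝ (Fin d)), K ⊆ Ω → IsCompact K →
      ∃ lam : ℝ, 1 < lam ∧ ∀ x ∈ K, ∀ ξ : EuclideanSpace ℝ (Fin d),
        lam⁻¹ * ‖ξ‖ ^ 2 ≤ ∑ i, ∑ j, A x i j * ξ i * ξ j ∧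
        ∑ i, ∑ j, A x i j * ξ i * ξ j ≤ lam * ‖ξ‖ ^ 2)
    (V : EuclideanSpace ℝ (Fin d) → ℝ) (hVc : ContinuousOn V Ω)
    (hnn : ∀ u, IsSmoothCS Ω u → 0 ≤ quadForm Ω A V u)
    (hexist : ∃ u : EuclideanSpace ℝ (Fin d) → ℝ, IsPosSolutionOn A V u Ω)
    (hnogs : ¬ ∃ φ : EuclideanSpace ℝ (Fin d) → ℝ, IsGroundState Ω A V φ) :
    ∃ W : EuclideanSpace ℝ (Fin d) → ℝ, ContinuousOn W Ω ∧ (∀ x ∈ Ω, 0 < W x) ∧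
      ∃ lam : ℝ, 0 < lam ∧
        ∃ u : EuclideanSpace ℝ (Fin d) → ℝ, ContDiffOn ℝ 2 u Ω ∧ (∀ x ∈ Ω, 0 < u x) ∧
          ∀ x ∈ Ω, Lop A V u x = lam * W x * u x := by
  obtain ⟨φ, hφ⟩ := hexist
  have hell : ∀ K ⊆ Ω, IsCompact K → ∃ c > 0, ∀ x ∈ K, ∀ ξ : EuclideanSpace ℝ (Fin d),
      c * ‖ξ‖ ^ 2 ≤ ∑ i, ∑ j, A x i j * ξ i * ξ j := fun K hK hKc => by
    obtain ⟨lam, hlam, h⟩ := hAell K hK hKc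
    exact ⟨lam⁻¹, inv_pos.2 (one_pos.trans hlam), fun x hx ξ => (h x hx ξ).1⟩
  obtain ⟨w₀, hw₀, x₀, hx₀, hpos₀⟩ := exists_isPosSuper_pos_of_not_hasMinimalGrowth hΩo hΩc
    hAsmooth hAsymm (fun x hx => by simpa using hell {x} (by simpa using hx) isCompact_singleton)
    hφ fun h => hnogs ⟨φ, hφ, h⟩
  set S := {x | x ∈ Ω ∧ ∃ w, IsPosSuper A V Ω w ∧ 0 < Lop A V w x} with hS
  have hnhds : ∀ {w}, IsPosSuper A V Ω w → ∀ x ∈ Ω, 0 < Lop A V w x →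
      ∀ᶠ y in 𝓝 x, 0 < Lop A V w y := fun hw x hx h =>
    ((continuousOn_Lop hΩo hAsmooth hVc hw.contDiffOn).continuousAt
      (hΩo.mem_nhds hx)).eventually_const_lt h
  have hSo : IsOpen S := by
    rw [isOpen_iff_mem_nhds]
    rintro x ⟨hx, w, hw, h⟩
    filter_upwards [hΩo.mem_nhds hx, hnhds hw x hx h] with y hy hy'
    exact ⟨hy, w, hw, hy'⟩
  have hScl : closure S ∩ Ω ⊆ S := by
    rintro x ⟨hxS, hx⟩
    obtain ⟨ε, hε, hball⟩ := Metric.isOpen_iff.1 hΩo x hx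
    obtain ⟨a, ⟨ha, w, hw, h⟩, hax⟩ := Metric.mem_closure_iff.1 hxS (ε / 2) (half_pos hε)
    have hsub : Metric.closedBall a (ε / 2) ⊆ Ω := fun y hy => hball <| by
      have h1 := dist_triangle y a x
      rw [Metric.mem_closedBall] at hy
      rw [dist_comm a x] at h1
      rw [Metric.mem_ball]
      linarith
    obtain ⟨c, hc, hcell⟩ := hell _ hsub (isCompact_closedBall a (ε / 2))
    obtain ⟨w', hw', h'⟩ := exists_isPosSuper_pos_of_mem_ball hΩo hAsmooth hVc (half_pos hε) hsub
      hc hcell hw h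
    exact ⟨hx, w', hw', h' x hax⟩
  have hΩS : Ω ⊆ S := hΩc.isPreconnected.subset_of_closure_inter_subset hSo
    ⟨x₀, hx₀, hx₀, w₀, hw₀, hpos₀⟩ hScl
  have hpt : ∀ x, ∃ w, IsPosSuper A V Ω w ∧ (x ∈ Ω → 0 < Lop A V w x) := fun x => by
    by_cases hx : x ∈ Ω
    · obtain ⟨-, w, hw, h⟩ := hΩS hx
      exact ⟨w, hw, fun _ => h⟩
    · exact ⟨w₀, hw₀, fun h => absurd h hx⟩
  choose w hw hwpos using hpt
  obtain ⟨t, -, htc, hcov⟩ := TopologicalSpace.countable_cover_nhdsWithin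
    (f := fun x => {y | 0 < Lop A V (w x) y}) (s := Ω)
    fun x hx => mem_nhdsWithin_of_mem_nhds (hnhds (hw x) x hx (hwpos x hx))
  have htne : t.Nonempty := by
    obtain ⟨y, hy, -⟩ := mem_iUnion₂.1 (hcov hx₀)
    exact ⟨y, hy⟩
  obtain ⟨e, rfl⟩ := htc.exists_eq_range htne
  obtain ⟨u, hu, hupos⟩ := exists_isPosSuper_of_seq hΩo hAsmooth fun n => hw (e n)
  have hLu : ∀ x ∈ Ω, 0 < Lop A V u x := fun x hx => by
    obtain ⟨_, ⟨n, rfl⟩, hn⟩ := mem_iUnion₂.1 (hcov hx)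
    exact hupos x hx ⟨n, hn⟩
  refine ⟨fun x => Lop A V u x / u x,
    (continuousOn_Lop hΩo hAsmooth hVc hu.contDiffOn).div hu.contDiffOn.continuousOn
      fun x hx => (hu.pos x hx).ne', fun x hx => div_pos (hLu x hx) (hu.pos x hx), 1, one_pos,
    u, hu.contDiffOn, hu.pos, fun x hx => ?_⟩
  rw [one_mul, div_mul_cancel₀ _ (hu.pos x hx).ne']
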